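/- arXiv:math/0207082 — 3 statements merged into one kernel-verified Lean document; each statement's English description precedes it below -/
import Mathlib

section
/- Let n : ℕ and let a : Fin (n+1) → ℝ be injective (the a_i are distinct real numbers). Let Pe(a) be the permutohedron, i.e. the convex hull over ℝ in the space Fin (n+1) → ℝ of the set {a ∘ σ : σ a permutation of Fin (n+1)}. Then the set of extreme points of Pe(a) is exactly the set {a ∘ σ : σ a permutation of Fin (n+1)}. -/
open Set

/-- The permutohedron `Pe(a)`: the convex hull in `Fin (n+1) → ℝ` of the vectors obtained
by permuting the coordinates of `a`. -/
def Pe (n : ℕ) (a : Fin (n + 1) → ℝ) : Set (Fin (n + 1) → ℝ) :=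
  convexHull ℝ {x | ∃ σ : Equiv.Perm (Fin (n + 1)), x = a ∘ σ}

theorem convex_setOf_sum_sq_le {ι : Type*} [Fintype ι] (r : ℝ) :
    Convex ℝ {x : ι → ℝ | ∑ i, x i ^ 2 ≤ r} := by
  have h : ConvexOn ℝ univ fun x : ι → ℝ => ∑ i, x i ^ 2 := by
    refine ⟨convex_univ, fun x _ y _ s t hs ht hst => ?_⟩
    simp only [smul_eq_mul, Pi.add_apply, Pi.smul_apply, Finset.mul_sum,
      ← Finset.sum_add_distrib]
    exact Finset.sum_le_sum fun i _ =>
      (even_two.convexOn_pow (𝕜 := ℝ)).2 (mem_univ (x i)) (mem_univ (y i)) hs ht hst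
  simpa using h.convex_le r

/-- A set of points of constant sum of squares lies in the extreme points of its convex hull. -/
theorem subset_extremePoints_convexHull_of_sum_sq_eq {ι : Type*} [Fintype ι] {r : ℝ}
    {S : Set (ι → ℝ)} (hS : ∀ x ∈ S, ∑ i, x i ^ 2 = r) :
    S ⊆ (convexHull ℝ S).extremePoints ℝ := by
  have hle : convexHull ℝ S ⊆ {x | ∑ i, x i ^ 2 ≤ r} :=
    convexHull_min (fun x hx => (hS x hx).le) (convex_setOf_sum_sq_le r)
  refine fun x hx => mem_extremePoints_iff_left.2 ⟨subset_convexHull ℝ S hx, ?_⟩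
  rintro y hy z hz ⟨s, t, hs, ht, hst, rfl⟩
  have hid : ∑ i, (s • y + t • z) i ^ 2 + s * t * ∑ i, (y i - z i) ^ 2 =
      s * ∑ i, y i ^ 2 + t * ∑ i, z i ^ 2 := by
    simp only [Finset.mul_sum, ← Finset.sum_add_distrib, Pi.add_apply, Pi.smul_apply, smul_eq_mul]
    refine Finset.sum_congr rfl fun i _ => ?_
    obtain rfl : t = 1 - s := by linarith
    ring
  have hprod : s * t * ∑ i, (y i - z i) ^ 2 ≤ 0 := by
    have hy' := mul_le_mul_of_nonneg_left (hle hy) hs.le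
    have hz' := mul_le_mul_of_nonneg_left (hle hz) ht.le
    have hr : s * r + t * r = r := by rw [← add_mul, hst, one_mul]
    linarith [hS _ hx]
  have hsum : ∑ i, (y i - z i) ^ 2 = 0 :=
    le_antisymm (nonpos_of_mul_nonpos_right hprod (mul_pos hs ht))
      (Finset.sum_nonneg fun i _ => sq_nonneg _)
  have hyz : y = z := by
    ext i
    have hi := (Finset.sum_eq_zero_iff_of_nonneg fun i _ => sq_nonneg (y i - z i)).1 hsum i
      (Finset.mem_univ i)
    exact sub_eq_zero.1 (pow_eq_zero_iff two_ne_zero |>.1 hi)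
  rw [← hyz, ← add_smul, hst, one_smul]

theorem permutohedron_extremePoints (n : ℕ) (a : Fin (n + 1) → ℝ)
    (ha : Function.Injective a) :
    Set.extremePoints ℝ (Pe n a) =
      {x | ∃ σ : Equiv.Perm (Fin (n + 1)), x = a ∘ σ} := by
  refine Subset.antisymm extremePoints_convexHull_subset
    (subset_extremePoints_convexHull_of_sum_sq_eq (r := ∑ i, a i ^ 2) ?_)
  rintro _ ⟨σ, rfl⟩
  exact Equiv.sum_comp σ fun i => a i ^ 2
end

section
/- Let n : ℕ and let a : Fin (n+1) → ℝ be injective. Then the affine span over ℝ of the set {a ∘ σ : σ a permutation of Fin (n+1)} in the space Fin (n+1) → ℝ is exactly the affine hyperplane {x : Fin (n+1) → ℝ | ∑_i x i = ∑_i a i}. In particular the permutohedron Pe(a) is a polytope of dimension n. -/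
open Set Finset

section PermutationOrbit

variable {k ι : Type*} [Field k] [Fintype ι]

/-- If `a` has distinct entries, the vectors obtained by permuting its coordinates span the
direction consisting of all vectors with zero coordinate sum. -/
theorem vectorSpan_range_comp_perm {a : ι → k} (ha : Function.Injective a) :
    vectorSpan k (Set.range fun σ : Equiv.Perm ι => a ∘ σ) =
      LinearMap.ker (∑ i, LinearMap.proj i : (ι → k) →ₗ[k] k) := by
  classical
  apply le_antisymm
  · rw [vectorSpan_def, Submodule.span_le]
    rintro _ ⟨_, ⟨σ, rfl⟩, _, ⟨τ, rfl⟩, rfl⟩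
    simp [Equiv.sum_comp]
  · have single_sub_single_mem (i j : ι) : Pi.single i 1 - Pi.single j 1 ∈
        vectorSpan k (Set.range fun σ : Equiv.Perm ι => a ∘ σ) := by
      by_cases hij : i = j
      · simp [hij]
      have hne : a i - a j ≠ 0 := sub_ne_zero.2 (ha.ne hij)
      have hmem : a ∘ (1 : Equiv.Perm ι) - a ∘ Equiv.swap i j ∈
          vectorSpan k (Set.range fun σ : Equiv.Perm ι => a ∘ σ) :=
        vsub_mem_vectorSpan k ⟨1, rfl⟩ ⟨Equiv.swap i j, rfl⟩
      rw [← Submodule.smul_mem_iff _ hne]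
      convert hmem using 1
      ext l
      by_cases hi : l = i
      · simp [hi, hij]
      by_cases hj : l = j
      · simp [hj, Ne.symm hij]
      · simp [hi, hj, Equiv.swap_apply_of_ne_of_ne hi hj]
    intro x hx
    have hx : ∑ i, x i = 0 := by simpa using hx
    rcases isEmpty_or_nonempty ι with _ | ⟨⟨j⟩⟩
    · simp [Subsingleton.elim x 0]
    have hsum : x = ∑ i, x i • (Pi.single i 1 - Pi.single j 1 : ι → k) := by
      simp only [smul_sub, Finset.sum_sub_distrib, ← Finset.sum_smul, hx, zero_smul, sub_zero]
      exact pi_eq_sum_univ' x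
    rw [hsum]
    exact Submodule.sum_mem _ fun i _ => Submodule.smul_mem _ _ (single_sub_single_mem i j)

/-- If `a` has distinct entries, the vectors obtained by permuting its coordinates affinely span
the hyperplane of vectors with the same coordinate sum as `a`. -/
theorem mem_affineSpan_range_comp_perm {a : ι → k} (ha : Function.Injective a) {x : ι → k} :
    x ∈ affineSpan k (Set.range fun σ : Equiv.Perm ι => a ∘ σ) ↔ ∑ i, x i = ∑ i, a i := by
  have hmem : a ∈ affineSpan k (Set.range fun σ : Equiv.Perm ι => a ∘ σ) :=
    subset_affineSpan k _ ⟨1, rfl⟩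
  rw [← AffineSubspace.vsub_right_mem_direction_iff_mem hmem, direction_affineSpan,
    vectorSpan_range_comp_perm ha]
  simp [sub_eq_zero]

/-- The vectors with zero coordinate sum form a subspace of codimension one. -/
theorem finrank_ker_sum_proj_add_one [Nonempty ι] :
    Module.finrank k (LinearMap.ker (∑ i, LinearMap.proj i : (ι → k) →ₗ[k] k)) + 1 =
      Fintype.card ι := by
  classical
  rw [Module.Dual.finrank_ker_add_one_of_ne_zero, Module.finrank_fintype_fun_eq_card]
  intro h
  obtain ⟨j⟩ := ‹Nonempty ι›
  simpa using LinearMap.congr_fun h (Pi.single j 1)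

end PermutationOrbit

theorem permutohedron_affineSpan (n : ℕ) (a : Fin (n + 1) → ℝ)
    (ha : Function.Injective a) :
    (affineSpan ℝ {x : Fin (n + 1) → ℝ | ∃ σ : Equiv.Perm (Fin (n + 1)), x = a ∘ σ} :
        Set (Fin (n + 1) → ℝ)) =
      {x : Fin (n + 1) → ℝ | ∑ i, x i = ∑ i, a i} ∧
    Module.finrank ℝ
      (affineSpan ℝ
        {x : Fin (n + 1) → ℝ | ∃ σ : Equiv.Perm (Fin (n + 1)), x = a ∘ σ}).direction = n := by
  have hrange : {x : Fin (n + 1) → ℝ | ∃ σ : Equiv.Perm (Fin (n + 1)), x = a ∘ σ} =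
      Set.range fun σ : Equiv.Perm (Fin (n + 1)) => a ∘ σ := by
    ext x
    simp [eq_comm]
  rw [hrange]
  refine ⟨Set.ext fun x => mem_affineSpan_range_comp_perm ha, ?_⟩
  rw [direction_affineSpan, vectorSpan_range_comp_perm ha]
  simpa using finrank_ker_sum_proj_add_one (k := ℝ) (ι := Fin (n + 1))
end

section
/- Let n : ℕ, let a : Fin (n+1) → ℝ be strictly monotone increasing, and let S be a nonempty proper subset of Fin (n+1) with m elements. Set M := ∑_{j : (j : ℕ) ≥ n+1−m} a j, the sum of the m largest values of a. Then: (i) every x in the permutohedron Pe(a) satisfies ∑_{i ∈ S} x i ≤ M; and (ii) the set F_S := {x ∈ Pe(a) | ∑_{i ∈ S} x i = M} is a nonempty exposed face of Pe(a) (it is the set of maximizers over Pe(a) of the linear functional x ↦ ∑_{i ∈ S} x i, and in particular IsExtreme ℝ (Pe(a)) F_S holds). -/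
open Set Finset

/-- A finite set on which `f` dominates its values elsewhere has the largest `f`-sum among the sets
of its cardinality. -/
theorem sum_le_sum_of_card_eq_of_dominates {ι : Type*} [DecidableEq ι] {f : ι → ℝ} {U T : Finset ι}
    (hc : U.card = T.card) (h : ∀ x ∈ T, ∀ y ∉ T, f y ≤ f x) :
    ∑ i ∈ U, f i ≤ ∑ i ∈ T, f i := by
  rw [← Finset.sum_sdiff_le_sum_sdiff]
  have hcd : (U \ T).card = (T \ U).card := Finset.card_sdiff_comm hc
  rcases (T \ U).eq_empty_or_nonempty with he | hne
  · rw [he, Finset.card_empty, Finset.card_eq_zero] at hcd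
    rw [he, hcd]
  · obtain ⟨k, hk, hmin⟩ := Finset.exists_min_image (T \ U) f hne
    calc ∑ i ∈ U \ T, f i ≤ (U \ T).card • f k :=
          Finset.sum_le_card_nsmul _ _ _ fun y hy =>
            h k (Finset.mem_sdiff.1 hk).1 y (Finset.mem_sdiff.1 hy).2
      _ = (T \ U).card • f k := by rw [hcd]
      _ ≤ ∑ i ∈ T \ U, f i := Finset.card_nsmul_le_sum _ _ _ hmin

theorem exists_perm_map_eq_of_card_eq {ι : Type*} [Fintype ι] [DecidableEq ι] {S T : Finset ι}
    (hc : S.card = T.card) : ∃ σ : Equiv.Perm ι, S.map σ.toEmbedding = T := by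
  refine ⟨(Finset.equivOfCardEq hc).extendSubtype, Finset.eq_of_subset_of_card_le ?_ (by simp [hc])⟩
  intro x hx
  obtain ⟨y, hy, rfl⟩ := Finset.mem_map.1 hx
  exact (Finset.equivOfCardEq hc).extendSubtype_mem y hy

theorem card_filter_sub_le_val {N m : ℕ} (hm : m ≤ N) :
    (Finset.univ.filter fun j : Fin N => N - m ≤ (j : ℕ)).card = m := by
  have h := Fin.card_filter_val_lt (n := N) (m := N - m)
  have h' := Finset.card_filter_add_card_filter_not (s := (Finset.univ : Finset (Fin N)))
    (fun j : Fin N => (j : ℕ) < N - m)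
  simp only [not_lt, Finset.card_univ, Fintype.card_fin] at h'
  omega

theorem permutohedron_facet (n : ℕ) (a : Fin (n + 1) → ℝ) (ha : StrictMono a)
    (S : Finset (Fin (n + 1))) (hS : S.Nonempty) (hS' : S ≠ Finset.univ) :
    letI M : ℝ := ∑ j ∈ Finset.univ.filter (fun j : Fin (n + 1) => n + 1 - S.card ≤ (j : ℕ)), a j
    (∀ x ∈ Pe n a, ∑ i ∈ S, x i ≤ M) ∧
    ({x ∈ Pe n a | ∑ i ∈ S, x i = M} : Set (Fin (n + 1) → ℝ)).Nonempty ∧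
    ({x ∈ Pe n a | ∑ i ∈ S, x i = M} : Set (Fin (n + 1) → ℝ)) =
      {x ∈ Pe n a | ∀ y ∈ Pe n a, ∑ i ∈ S, y i ≤ ∑ i ∈ S, x i} ∧
    IsExtreme ℝ (Pe n a) ({x ∈ Pe n a | ∑ i ∈ S, x i = M} : Set (Fin (n + 1) → ℝ)) := by
  have hT := card_filter_sub_le_val (N := n + 1) (m := S.card) (by simpa using S.card_le_univ)
  have hdom : ∀ x ∈ Finset.univ.filter (fun j : Fin (n + 1) => n + 1 - S.card ≤ (j : ℕ)),
      ∀ y ∉ Finset.univ.filter (fun j : Fin (n + 1) => n + 1 - S.card ≤ (j : ℕ)), a y ≤ a x := by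
    intro x hx y hy
    simp only [Finset.mem_filter, Finset.mem_univ, true_and] at hx hy
    exact ha.monotone (Fin.le_def.2 (by omega))
  generalize Finset.univ.filter (fun j : Fin (n + 1) => n + 1 - S.card ≤ (j : ℕ)) = T at *
  let l : StrongDual ℝ (Fin (n + 1) → ℝ) := ∑ i ∈ S, ContinuousLinearMap.proj i
  have hl (x : Fin (n + 1) → ℝ) : l x = ∑ i ∈ S, x i := by simp [l]
  have hsum (σ : Equiv.Perm (Fin (n + 1))) :
      ∑ i ∈ S, (a ∘ σ) i = ∑ i ∈ S.map σ.toEmbedding, a i := by simp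
  have hle : ∀ x ∈ Pe n a, ∑ i ∈ S, x i ≤ ∑ j ∈ T, a j := by
    have hsub : Pe n a ⊆ {x | l x ≤ ∑ j ∈ T, a j} := by
      refine convexHull_min ?_ (convex_halfSpace_le l.isLinear _)
      rintro _ ⟨σ, rfl⟩
      rw [Set.mem_ofPred_eq, hl, hsum]
      exact sum_le_sum_of_card_eq_of_dominates (by simp [hT]) hdom
    exact fun x hx => hl x ▸ hsub hx
  obtain ⟨z, hz, hzM⟩ : ∃ z ∈ Pe n a, ∑ i ∈ S, z i = ∑ j ∈ T, a j := by
    obtain ⟨σ, hσ⟩ := exists_perm_map_eq_of_card_eq hT.symm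
    exact ⟨a ∘ σ, subset_convexHull ℝ _ ⟨σ, rfl⟩, by rw [hsum, hσ]⟩
  have heq : ({x ∈ Pe n a | ∑ i ∈ S, x i = ∑ j ∈ T, a j} : Set (Fin (n + 1) → ℝ)) =
      {x ∈ Pe n a | ∀ y ∈ Pe n a, ∑ i ∈ S, y i ≤ ∑ i ∈ S, x i} := by
    ext x
    refine and_congr_right fun hx => ⟨fun h y hy => h ▸ hle y hy, fun h => ?_⟩
    exact (hle x hx).antisymm (hzM ▸ h z hz)
  refine ⟨hle, ⟨z, hz, hzM⟩, heq, ?_⟩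
  rw [heq]
  simpa only [ContinuousLinearMap.toExposed, hl] using
    (ContinuousLinearMap.toExposed.isExposed (l := l) (A := Pe n a)).isExtreme
end
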